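/- (L-sequence-weighted Downward Closure property) Let δ be a finite C-sequence dataset, k a positive integer, and L, L' two L-sequences such that L is an L-subsequence of L' and |L'| ≤ k. Then LWU_k(L') ≤ LWU_k(L). -/

import Mathlib

open scoped Classical

/-- A C-eventset: a finite set of event labels together with a duration. -/
abbrev CEventset (α : Type*) := Finset α × ℕ

/-- A C-sequence: a finite list of C-eventsets. -/
abbrev CSeq (α : Type*) := List (CEventset α)

/-- An L-sequence: a finite list of (nonempty) finite label sets. -/
abbrev LSeq (α : Type*) := List (Finset α)

/-- Utility of a C-eventset: duration times the sum of external utilities of its labels. -/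
noncomputable def ue {α : Type*} (p : α → NNReal) (σ : CEventset α) : NNReal :=
  (σ.2 : NNReal) * ∑ l ∈ σ.1, p l

/-- Utility of a C-sequence: the sum of the utilities of its C-eventsets. -/
noncomputable def us {α : Type*} (p : α → NNReal) (C : CSeq α) : NNReal :=
  (C.map (ue p)).sum

/-- Containment of C-eventsets: label-set inclusion with equal durations. -/
def CContains {α : Type*} (σa σb : CEventset α) : Prop :=
  σa.1 ⊆ σb.1 ∧ σa.2 = σb.2

/-- `C` is a C-subsequence of `C'`: there is a strictly increasing index map under
which each C-eventset of `C` is contained in the corresponding one of `C'`. -/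
def CSub {α : Type*} (C C' : CSeq α) : Prop :=
  ∃ C₂ : CSeq α, C₂.Sublist C' ∧ List.Forall₂ CContains C C₂

/-- A C-sequence matches an L-sequence iff they have equal length and the label set of
each C-eventset equals the corresponding label set of the L-sequence. -/
def Matches {α : Type*} (C : CSeq α) (L : LSeq α) : Prop :=
  C.map Prod.fst = L

/-- `L` is an L-subsequence of `L'`. -/
def LSub {α : Type*} (L L' : LSeq α) : Prop :=
  ∃ L₂ : LSeq α, L₂.Sublist L' ∧ List.Forall₂ (· ⊆ ·) L L₂

/-- Maximum of the utility set `u_l(L, C)` (max of the empty set is 0). -/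
noncomputable def ulMax {α : Type*} (p : α → NNReal) (L : LSeq α) (C : CSeq α) : NNReal :=
  sSup {x | ∃ C', Matches C' L ∧ CSub C' C ∧ us p C' = x}

/-- Maximum utility `u_max(L)` of an L-sequence in a C-sequence dataset. -/
noncomputable def umax {α : Type*} (p : α → NNReal) (δ : Finset (CSeq α)) (L : LSeq α) :
    NNReal :=
  ∑ C ∈ δ, ulMax p L C

/-- Maximum utility of `k` C-eventsets in a C-sequence (max of the empty set is 0). -/
noncomputable def umaxk {α : Type*} (p : α → NNReal) (C : CSeq α) (k : ℕ) : NNReal :=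
  sSup {x | ∃ C', CSub C' C ∧ C'.length ≤ k ∧ us p C' = x}

/-- L-sequence-weighted utilization `LWU_k(L)` over the dataset `δ`. -/
noncomputable def LWU {α : Type*} (p : α → NNReal) (δ : Finset (CSeq α)) (k : ℕ)
    (L : LSeq α) : NNReal :=
  ∑ C ∈ δ, if ∃ C', CSub C' C ∧ Matches C' L then umaxk p C k else 0

/-- Projected utilization `P_k(L) = u_max(L) + LWU_{k - |L|}(L)`. -/
noncomputable def Pk {α : Type*} (p : α → NNReal) (δ : Finset (CSeq α)) (k : ℕ)
    (L : LSeq α) : NNReal :=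
  umax p δ L + LWU p δ (k - L.length) L

theorem lsub_trans_aux {α : Type*} {A B C : LSeq α} (h₁ : LSub A B) (h₂ : LSub B C) :
    LSub A C := by
  obtain ⟨X, hX, hAX⟩ := h₁
  obtain ⟨Y, hY, hBY⟩ := h₂
  have h1 : List.SublistForall₂ (· ⊆ ·) A B :=
    List.sublistForall₂_iff.2 ⟨X, hAX, hX⟩
  have h2 : List.SublistForall₂ (· ⊆ ·) B C :=
    List.sublistForall₂_iff.2 ⟨Y, hBY, hY⟩
  obtain ⟨Z, hZ, hZC⟩ := List.sublistForall₂_iff.1 (_root_.trans h1 h2)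
  exact ⟨Z, hZC, hZ⟩

theorem lift_aux {α : Type*} (D : CSeq α) : ∀ L : LSeq α,
    List.Forall₂ (· ⊆ ·) L (D.map Prod.fst) →
    ∃ C', List.Forall₂ CContains C' D ∧ Matches C' L := by
  induction D with
  | nil =>
    intro L h
    cases h
    exact ⟨[], List.Forall₂.nil, rfl⟩
  | cons d D ih =>
    intro L h
    cases h with
    | cons h1 h2 =>
      rename_i a l
      obtain ⟨C', hC, hm⟩ := ih _ h2
      refine ⟨(a, d.2) :: C', List.Forall₂.cons ⟨h1, rfl⟩ hC, ?_⟩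
      unfold Matches at *
      simp [hm]

theorem occurs_iff_aux {α : Type*} (C : CSeq α) (L : LSeq α) :
    (∃ C', CSub C' C ∧ Matches C' L) ↔ LSub L (C.map Prod.fst) := by
  constructor
  · rintro ⟨C', ⟨D, hD, hf⟩, rfl⟩
    refine ⟨D.map Prod.fst, hD.map _, ?_⟩
    rw [List.forall₂_map_left_iff, List.forall₂_map_right_iff]
    exact hf.imp fun _ _ h => h.1
  · rintro ⟨L₂, hs, hf⟩
    obtain ⟨D, hD, rfl⟩ := List.sublist_map_iff.1 hs
    obtain ⟨C', h1, h2⟩ := lift_aux D L hf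
    exact ⟨C', ⟨D, hD, h1⟩, h2⟩

/-- LDC property: if L ⊑ L' and |L'| ≤ k then LWU_k(L') ≤ LWU_k(L). -/
theorem LWU_anti {α : Type*} (p : α → NNReal) (δ : Finset (CSeq α)) (k : ℕ)
    (hk : 0 < k) (L L' : LSeq α)
    (hL : ∀ c ∈ L, c.Nonempty) (hL' : ∀ c ∈ L', c.Nonempty)
    (hsub : LSub L L') (hlen : L'.length ≤ k) :
    LWU p δ k L' ≤ LWU p δ k L := by
  unfold LWU
  refine Finset.sum_le_sum fun C _ => ?_
  by_cases h : ∃ C', CSub C' C ∧ Matches C' L'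
  · have h2 : ∃ C', CSub C' C ∧ Matches C' L :=
      (occurs_iff_aux C L).2 (lsub_trans_aux hsub ((occurs_iff_aux C L').1 h))
    rw [if_pos h, if_pos h2]
  · rw [if_neg h]
    exact zero_le
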